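/- For every integer K ≥ 2, the one-round influence ν_K is not submodular: there exist a finite simple undirected graph G=(V,E), sets S ⊆ T ⊆ V, and a node u ∈ V \ T such that ν_K(u|S) < ν_K(u|T). (For instance, for K = 3, take V = {w, v, u, z} with z adjacent to each of w, v, u, S = {v}, and T = {v, w}: then ν_3(u|S) = 1 < 2 = ν_3(u|T).) -/

import Mathlib

open Finset

/-- The one-round influence group centrality of `K`-complex contagion:
`ν_K(S) = |S| + |{v ∈ V∖S : |N(v) ∩ S| ≥ K}|` (stated with classical decidability so that
no `DecidableRel` instance is needed). -/
noncomputable def nuK {V : Type} [Fintype V] [DecidableEq V] (G : SimpleGraph V)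
    (K : ℕ) (S : Finset V) : ℝ :=
  letI : DecidableRel G.Adj := Classical.decRel _
  (S.card : ℝ) +
    ((univ.filter (fun v => v ∉ S ∧ K ≤ (G.neighborFinset v ∩ S).card)).card : ℝ)

lemma nuK_top (n K : ℕ) (S : Finset (Fin n)) :
    nuK (⊤ : SimpleGraph (Fin n)) K S = if S.card < K then (S.card : ℝ) else n := by
  classical
  have key : ∀ v, v ∉ S → (univ.filter (fun w => v ≠ w)) ∩ S = S := by
    intro v hv
    ext w
    simp only [mem_inter, mem_filter, mem_univ, true_and]
    constructor
    · exact fun h => h.2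
    · exact fun h => ⟨fun e => hv (e ▸ h), h⟩
  have h2 : nuK (⊤ : SimpleGraph (Fin n)) K S
      = S.card + ((univ.filter (fun v => v ∉ S ∧ K ≤ S.card)).card : ℝ) := by
    unfold nuK
    congr 3
    ext v
    simp only [mem_filter, mem_univ, true_and]
    refine and_congr_right fun hv => ?_
    rw [← key v hv]
    simp only [key v hv]
    have : ∀ A : Finset (Fin n), (∀ w, w ∈ A ↔ v ≠ w) → A ∩ S = S := by
      intro A hA
      rw [← key v hv]
      ext w
      simp [hA]
    rw [this _ (by intro w; simp)]
  rw [h2]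
  split_ifs with h
  · simp [Nat.not_le.mpr h]
  · have hle := Nat.not_lt.mp h
    have : (univ.filter (fun v => v ∉ S ∧ K ≤ S.card)) = Sᶜ := by
      ext v; simp [hle]
    rw [this]
    have := Finset.card_add_card_compl S
    rw [Fintype.card_fin] at this
    exact_mod_cast this

/-- For every integer `K ≥ 2`, the one-round influence `ν_K` is not submodular: there exist
a finite simple undirected graph `G = (V,E)`, sets `S ⊆ T ⊆ V`, and a node `u ∈ V∖T` such
that `ν_K(u|S) < ν_K(u|T)`, where `ν_K(u|S) = ν_K(S ∪ {u}) − ν_K(S)`. -/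
theorem stmt13 (K : ℕ) (hK : 2 ≤ K) :
    ∃ (n : ℕ) (G : SimpleGraph (Fin n)) (S T : Finset (Fin n)) (u : Fin n),
      S ⊆ T ∧ u ∉ T ∧
        nuK G K (insert u S) - nuK G K S < nuK G K (insert u T) - nuK G K T := by
  obtain ⟨m, rfl⟩ := Nat.exists_eq_add_of_le' hK
  refine ⟨m + 3, ⊤, Iio ⟨m, by omega⟩, Iio ⟨m + 1, by omega⟩, ⟨m + 1, by omega⟩, ?_, ?_, ?_⟩
  · intro x
    simp only [mem_Iio, Fin.lt_def]
    omega
  · simp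
  · rw [nuK_top, nuK_top, nuK_top, nuK_top, card_insert_of_notMem (by simp),
      card_insert_of_notMem (by simp [Fin.lt_def]), Fin.card_Iio, Fin.card_Iio]
    simp only
    rw [if_pos (by omega), if_pos (by omega), if_neg (by omega)]
    push_cast
    linarith
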